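/- arXiv:2412.06379 — 6 statements merged into one kernel-verified Lean document; each statement's English description precedes it below -/
import Mathlib

section
/- Let A be an n×n real matrix and let x ∈ ℝ^n be a nonzero vector with all entries nonnegative and with x_i = 0 for at least one index i. If x is a right eigenvector of A (i.e., Ax = λx for some real λ) or a left eigenvector of A (i.e., xᵀA = λxᵀ for some real λ), then A is not algebraically positive. -/
open Matrix

/-- A real square matrix is algebraically positive if some real polynomial
evaluated at it has all entries positive. -/
def AlgPositive {n : ℕ} (M : Matrix (Fin n) (Fin n) ℝ) : Prop :=
  ∃ f : Polynomial ℝ, ∀ i j, 0 < Polynomial.aeval M f i j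

theorem aeval_mulVec_of_mulVec_eq_smul {ι R : Type*} [Fintype ι] [DecidableEq ι] [CommRing R]
    {A : Matrix ι ι R} {x : ι → R} {μ : R} (h : A *ᵥ x = μ • x) (f : Polynomial R) :
    Polynomial.aeval A f *ᵥ x = f.eval μ • x := by
  induction f using Polynomial.induction_on with
  | C a => simp [Algebra.algebraMap_eq_smul_one, smul_mulVec]
  | add p q hp hq => simp only [map_add, add_mulVec, hp, hq, Polynomial.eval_add, add_smul]
  | monomial k a ih =>
    rw [pow_succ, ← mul_assoc, map_mul, Polynomial.aeval_X, ← mulVec_mulVec, h, mulVec_smul, ih,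
      smul_smul, Polynomial.eval_mul_X, mul_comm]

theorem aeval_transpose {ι R : Type*} [Fintype ι] [DecidableEq ι] [CommRing R]
    (A : Matrix ι ι R) (f : Polynomial R) :
    Polynomial.aeval Aᵀ f = (Polynomial.aeval A f)ᵀ := by
  simp only [Polynomial.aeval_eq_sum_range, transpose_sum, transpose_smul, transpose_pow]

theorem AlgPositive.transpose {n : ℕ} {A : Matrix (Fin n) (Fin n) ℝ} (h : AlgPositive A) :
    AlgPositive Aᵀ := by
  obtain ⟨f, hf⟩ := h
  exact ⟨f, fun i j => by simpa only [aeval_transpose, transpose_apply] using hf j i⟩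

theorem AlgPositive.eigenvector_ne_zero {n : ℕ} {A : Matrix (Fin n) (Fin n) ℝ}
    (hA : AlgPositive A) {x : Fin n → ℝ} (hx : x ≠ 0) (hx_nonneg : ∀ i, 0 ≤ x i) {μ : ℝ}
    (h : A *ᵥ x = μ • x) (i : Fin n) : x i ≠ 0 := by
  intro hi
  obtain ⟨f, hf⟩ := hA
  obtain ⟨j, hj⟩ := Function.ne_iff.mp hx
  have hpos : 0 < (Polynomial.aeval A f *ᵥ x) i :=
    Finset.sum_pos' (fun k _ => mul_nonneg (hf i k).le (hx_nonneg k))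
      ⟨j, Finset.mem_univ j, mul_pos (hf i j) ((hx_nonneg j).lt_of_ne' hj)⟩
  simp [aeval_mulVec_of_mulVec_eq_smul h, hi] at hpos

/-- If a nonzero nonnegative vector with some zero entry is a left or
right eigenvector of `A`, then `A` is not algebraically positive. -/
theorem stmt_0 {n : ℕ} (A : Matrix (Fin n) (Fin n) ℝ) (x : Fin n → ℝ)
    (hx_ne : x ≠ 0) (hx_nonneg : ∀ i, 0 ≤ x i) (hx_zero : ∃ i, x i = 0)
    (h_eig : (∃ lam : ℝ, A.mulVec x = lam • x) ∨ (∃ lam : ℝ, Matrix.vecMul x A = lam • x)) :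
    ¬ AlgPositive A := by
  intro hA
  obtain ⟨i, hi⟩ := hx_zero
  rcases h_eig with ⟨μ, h⟩ | ⟨μ, h⟩
  · exact hA.eigenvector_ne_zero hx_ne hx_nonneg h i hi
  · exact hA.transpose.eigenvector_ne_zero hx_ne hx_nonneg ((mulVec_transpose A x).trans h) i hi
end

section
/- Let n be an even positive integer and let A be an n×n real skew-symmetric matrix (Aᵀ = −A). Then A is not algebraically positive. -/
open Matrix

/-- If a matrix with positive entries maps a nonnegative vector to one with a zero coordinate,
then that nonnegative vector is zero. -/
theorem eq_zero_of_mulVec_apply_eq_zero {n : ℕ} {P : Matrix (Fin n) (Fin n) ℝ}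
    (hP : ∀ i j, 0 < P i j) {u : Fin n → ℝ} (hu : ∀ i, 0 ≤ u i) {k : Fin n}
    (hk : (P *ᵥ u) k = 0) : u = 0 := by
  rw [mulVec_eq_sum, Finset.sum_apply] at hk
  have hsum := (Finset.sum_eq_zero_iff_of_nonneg fun j _ => by
    simpa using mul_nonneg (hP k j).le (hu j)).1 hk
  refine funext fun j => ?_
  simpa [(hP k j).ne'] using hsum j (Finset.mem_univ j)

/-- If a matrix with positive entries has a positive eigenvector, then that eigenvector spans
its eigenspace. -/
theorem exists_eq_smul_of_mulVec_eq_smul {n : ℕ} (hn : 0 < n) {P : Matrix (Fin n) (Fin n) ℝ}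
    (hP : ∀ i j, 0 < P i j) {v w : Fin n → ℝ} {μ : ℝ} (hv : ∀ i, 0 < v i)
    (hPv : P *ᵥ v = μ • v) (hPw : P *ᵥ w = μ • w) : ∃ c : ℝ, w = c • v := by
  have : Nonempty (Fin n) := ⟨⟨0, hn⟩⟩
  obtain ⟨k, hk⟩ := Finite.exists_min fun i => w i / v i
  refine ⟨w k / v k, ?_⟩
  set c := w k / v k with hc
  have hu : ∀ i, 0 ≤ (w - c • v) i := fun i => by
    have := (le_div_iff₀ (hv i)).1 (hk i)
    simpa using this
  have huk : (w - c • v) k = 0 := by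
    simp [hc, div_mul_cancel₀ _ (hv k).ne']
  have hPu : (P *ᵥ (w - c • v)) k = 0 := by
    have : P *ᵥ (w - c • v) = μ • (w - c • v) := by
      rw [mulVec_sub, mulVec_smul, hPv, hPw, smul_sub, smul_comm]
    rw [this, Pi.smul_apply, huk, smul_zero]
  exact sub_eq_zero.1 (eq_zero_of_mulVec_apply_eq_zero hP hu hPu)

/-- The quadratic form of a real square matrix attains its maximum on the unit sphere, which
bounds it everywhere. -/
theorem exists_dotProduct_mulVec_le {n : ℕ} (hn : 0 < n) (S : Matrix (Fin n) (Fin n) ℝ) :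
    ∃ x : Fin n → ℝ, x ⬝ᵥ x = 1 ∧ ∀ z, z ⬝ᵥ (S *ᵥ z) ≤ (x ⬝ᵥ (S *ᵥ x)) * (z ⬝ᵥ z) := by
  have hcomp : IsCompact {x : Fin n → ℝ | x ⬝ᵥ x = 1} := by
    refine (isCompact_univ_pi fun _ => isCompact_Icc (a := (-1 : ℝ)) (b := 1)).of_isClosed_subset
      (isClosed_eq (by fun_prop) continuous_const) fun x hx i _ => ?_
    have h1 : x i * x i ≤ x ⬝ᵥ x :=
      Finset.single_le_sum (f := fun i => x i * x i) (fun j _ => mul_self_nonneg (x j))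
        (Finset.mem_univ i)
    rw [hx.out] at h1
    exact abs_le.1 ((sq_le_one_iff_abs_le_one _).1 (by nlinarith))
  obtain ⟨x, hx, hmax⟩ := hcomp.exists_isMaxOn
    ⟨Pi.single ⟨0, hn⟩ 1, by simp⟩
    (f := fun x => x ⬝ᵥ (S *ᵥ x)) (by fun_prop)
  refine ⟨x, hx, fun z => ?_⟩
  rcases eq_or_ne z 0 with rfl | hz
  · simp
  have hpos : 0 < z ⬝ᵥ z := by
    refine lt_of_le_of_ne (Finset.sum_nonneg fun j _ => mul_self_nonneg (z j)) ?_
    exact fun h => hz (dotProduct_self_eq_zero.1 h.symm)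
  set r := √(z ⬝ᵥ z) with hr
  have hrr : r * r = z ⬝ᵥ z := Real.mul_self_sqrt hpos.le
  have hr0 : 0 < r := Real.sqrt_pos.2 hpos
  have hmem : (r⁻¹ • z) ⬝ᵥ (r⁻¹ • z) = 1 := by
    rw [smul_dotProduct, dotProduct_smul, ← hrr, smul_eq_mul, smul_eq_mul]
    field_simp
  have hle : (r⁻¹ • z) ⬝ᵥ (S *ᵥ (r⁻¹ • z)) ≤ x ⬝ᵥ (S *ᵥ x) := hmax hmem
  rw [mulVec_smul, smul_dotProduct, dotProduct_smul, smul_eq_mul, smul_eq_mul, ← mul_assoc,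
    ← mul_inv, hrr, inv_mul_le_iff₀ hpos] at hle
  linarith

/-- A symmetric real matrix with positive entries has an eigenvector with positive entries. -/
theorem exists_pos_eigenvector_of_isSymm {n : ℕ} (hn : 0 < n) {S : Matrix (Fin n) (Fin n) ℝ}
    (hS : ∀ i j, 0 < S i j) (hsymm : Sᵀ = S) :
    ∃ (v : Fin n → ℝ) (μ : ℝ), (∀ i, 0 < v i) ∧ S *ᵥ v = μ • v := by
  obtain ⟨x, hx, hmax⟩ := exists_dotProduct_mulVec_le hn S
  set μ := x ⬝ᵥ (S *ᵥ x) with hμ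
  have hpsd : (μ • (1 : Matrix (Fin n) (Fin n) ℝ) - S).PosSemidef := by
    refine .of_dotProduct_mulVec_nonneg ?_ fun z => ?_
    · simp [IsHermitian, conjTranspose_eq_transpose_of_trivial, hsymm]
    · simpa [sub_mulVec, smul_mulVec, dotProduct_sub] using hmax z
  have hy : (fun i => |x i|) ⬝ᵥ (fun i => |x i|) = 1 := by
    rw [← hx]
    simp [dotProduct]
  have hge : μ ≤ (fun i => |x i|) ⬝ᵥ (S *ᵥ fun i => |x i|) := by
    rw [hμ]
    simp only [dotProduct, mulVec, Finset.mul_sum]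
    refine Finset.sum_le_sum fun i _ => Finset.sum_le_sum fun j _ => ?_
    refine (le_abs_self _).trans_eq ?_
    rw [abs_mul, abs_mul, abs_of_pos (hS i j)]
  have heig : S *ᵥ (fun i => |x i|) = μ • fun i => |x i| := by
    have hzero := (hpsd.dotProduct_mulVec_zero_iff fun i => |x i|).1 (by
      refine le_antisymm ?_ (hpsd.dotProduct_mulVec_nonneg _)
      rw [star_trivial, sub_mulVec, smul_mulVec, one_mulVec, dotProduct_sub, dotProduct_smul, hy]
      simpa using hge)
    rw [sub_mulVec, smul_mulVec, one_mulVec] at hzero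
    exact (sub_eq_zero.1 hzero).symm
  refine ⟨fun i => |x i|, μ, fun i => abs_pos.2 fun hi => ?_, heig⟩
  have hsum : (S *ᵥ fun i => |x i|) i = 0 := by simp [heig, hi]
  have hx0 : x = 0 := funext fun j => abs_eq_zero.1
    (congrFun (eq_zero_of_mulVec_apply_eq_zero hS (fun j => abs_nonneg (x j)) hsum) j)
  simp [hx0] at hx

/-- A real skew-symmetric matrix has zero quadratic form. -/
theorem dotProduct_mulVec_self_of_transpose_eq_neg {n : ℕ} {A : Matrix (Fin n) (Fin n) ℝ}
    (hA : Aᵀ = -A) (v : Fin n → ℝ) : v ⬝ᵥ (A *ᵥ v) = 0 := by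
  have h : v ⬝ᵥ (A *ᵥ v) = -(v ⬝ᵥ (A *ᵥ v)) := by
    conv_lhs => rw [dotProduct_mulVec, ← mulVec_transpose, hA, neg_mulVec, neg_dotProduct,
      dotProduct_comm]
  linarith

/-- A real skew-symmetric matrix of odd order is singular. -/
theorem det_eq_zero_of_transpose_eq_neg {m : ℕ} (hm : Odd m) {B : Matrix (Fin m) (Fin m) ℝ}
    (hB : Bᵀ = -B) : B.det = 0 := by
  have h := det_transpose B
  rw [hB, det_neg, Fintype.card_fin, hm.neg_one_pow] at h
  linarith

/-- A real skew-symmetric matrix of even order that kills a vector with nonzero first coordinate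
also kills a nonzero vector with zero first coordinate. -/
theorem exists_mulVec_eq_zero_of_transpose_eq_neg {m : ℕ} (hm : Odd m)
    {A : Matrix (Fin (m + 1)) (Fin (m + 1)) ℝ} (hA : Aᵀ = -A) {v : Fin (m + 1) → ℝ}
    (hv : v 0 ≠ 0) (hAv : A *ᵥ v = 0) : ∃ w, w ≠ 0 ∧ w 0 = 0 ∧ A *ᵥ w = 0 := by
  have hB : (A.submatrix Fin.succ Fin.succ)ᵀ = -A.submatrix Fin.succ Fin.succ := by
    rw [transpose_submatrix, hA]
    rfl
  obtain ⟨w, hw, hBw⟩ := exists_mulVec_eq_zero_iff.2 (det_eq_zero_of_transpose_eq_neg hm hB)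
  have hsucc : ∀ i : Fin m, (A *ᵥ (Fin.cons 0 w : Fin (m + 1) → ℝ)) i.succ = 0 := fun i => by
    have := congrFun hBw i
    simpa [mulVec, dotProduct, Fin.sum_univ_succ] using this
  have hdot : v ⬝ᵥ (A *ᵥ (Fin.cons 0 w : Fin (m + 1) → ℝ)) = 0 := by
    rw [dotProduct_mulVec, ← mulVec_transpose, hA, neg_mulVec, hAv, neg_zero, zero_dotProduct]
  rw [dotProduct, Fin.sum_univ_succ] at hdot
  simp only [hsucc, mul_zero, Finset.sum_const_zero, add_zero] at hdot
  refine ⟨Fin.cons 0 w, fun h => hw (funext fun i => ?_), rfl, funext fun i => ?_⟩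
  · simpa using congrFun h i.succ
  · refine Fin.cases ?_ hsucc i
    exact (mul_eq_zero.1 hdot).resolve_left hv

/-- A polynomial in a matrix acts on the kernel of the matrix by its constant coefficient. -/
theorem aeval_mulVec_of_mulVec_eq_zero {n : ℕ} {A : Matrix (Fin n) (Fin n) ℝ} {w : Fin n → ℝ}
    (hw : A *ᵥ w = 0) (f : Polynomial ℝ) :
    Polynomial.aeval A f *ᵥ w = f.coeff 0 • w := by
  conv_lhs => rw [← Polynomial.divX_mul_X_add f]
  rw [map_add, map_mul, Polynomial.aeval_X, Polynomial.aeval_C, add_mulVec, ← mulVec_mulVec, hw,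
    mulVec_zero, zero_add, Algebra.algebraMap_eq_smul_one, smul_mulVec, one_mulVec]

/-- A real skew-symmetric matrix of even (positive) order is not
algebraically positive. -/
theorem stmt_4 {n : ℕ} (hn : 0 < n) (hn_even : Even n)
    (A : Matrix (Fin n) (Fin n) ℝ) (hskew : Aᵀ = -A) :
    ¬ AlgPositive A := by
  rintro ⟨f, hf⟩
  set P := Polynomial.aeval A f with hP
  have hcomm : P * A = A * P := by
    have := Polynomial.aeval_mul (x := A) (p := f) (q := Polynomial.X)
    rw [mul_comm, Polynomial.aeval_mul, Polynomial.aeval_X] at this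
    exact this.symm
  have hcommT : Pᵀ * A = A * Pᵀ := by
    have := congrArg transpose hcomm
    rw [transpose_mul, transpose_mul, hskew, neg_mul, mul_neg, neg_inj] at this
    exact this.symm
  have hS : ∀ i j, 0 < (P + Pᵀ) i j := fun i j => add_pos (hf i j) (hf j i)
  obtain ⟨v, μ, hv, hSv⟩ := exists_pos_eigenvector_of_isSymm hn hS
    (by rw [transpose_add, transpose_transpose, add_comm])
  have hSAv : (P + Pᵀ) *ᵥ (A *ᵥ v) = μ • (A *ᵥ v) := by
    rw [mulVec_mulVec, add_mul, hcomm, hcommT, ← mul_add, ← mulVec_mulVec, hSv, mulVec_smul]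
  have hAv : A *ᵥ v = 0 := by
    obtain ⟨c, hc⟩ := exists_eq_smul_of_mulVec_eq_smul hn hS hv hSv hSAv
    have h0 := dotProduct_mulVec_self_of_transpose_eq_neg hskew v
    rw [hc, dotProduct_smul, smul_eq_mul, mul_eq_zero] at h0
    rcases h0 with h0 | h0
    · rw [hc, h0, zero_smul]
    · exact absurd (congrFun (dotProduct_self_eq_zero.1 h0) ⟨0, hn⟩) (hv _).ne'
  obtain ⟨m, rfl⟩ : ∃ m, n = m + 1 := ⟨n - 1, by lia⟩
  have hm : Odd m := by
    rw [Nat.even_add_one, Nat.not_even_iff_odd] at hn_even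
    exact hn_even
  obtain ⟨w, hw, hw0, hAw⟩ :=
    exists_mulVec_eq_zero_of_transpose_eq_neg hm hskew (hv 0).ne' hAv
  obtain ⟨c, hc⟩ := exists_eq_smul_of_mulVec_eq_smul hn hf hv
    (aeval_mulVec_of_mulVec_eq_zero hAv f) (aeval_mulVec_of_mulVec_eq_zero hAw f)
  rw [hc, Pi.smul_apply, smul_eq_mul, mul_eq_zero] at hw0
  exact hw (by rw [hc, hw0.resolve_right (hv 0).ne', zero_smul])
end

section
/- Let A be an n×n sign pattern of cycle form that requires algebraic positivity. Then: (1) there do not exist indices i, j such that a_{i,i+1} = 0 and a_{j+1,j} = 0 (indices modulo n); and (2) there do not exist indices i, j such that a_{i,i+1} ∈ {-, 0}, a_{i+1,i} ∈ {+, 0}, a_{j+1,j} ∈ {-, 0}, and a_{j,j+1} ∈ {+, 0} (indices modulo n). -/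
open Matrix

/-- `B` belongs to the qualitative class of the sign pattern `A`. -/
def InQClass {n : ℕ} (A : Matrix (Fin n) (Fin n) SignType)
    (B : Matrix (Fin n) (Fin n) ℝ) : Prop :=
  ∀ i j, SignType.sign (B i j) = A i j

/-- The sign pattern `A` requires algebraic positivity. -/
def RequiresAP {n : ℕ} (A : Matrix (Fin n) (Fin n) SignType) : Prop :=
  ∀ B : Matrix (Fin n) (Fin n) ℝ, InQClass A B → AlgPositive B

/-- An `n × n` sign pattern (indices read modulo `n`) is of cycle form if off-diagonal
entries away from the cycle `(0, 1, …, n-1, 0)` vanish and every edge of the cycle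
carries at least one nonzero arc. -/
def CycleForm {n : ℕ} [NeZero n] (A : Matrix (Fin n) (Fin n) SignType) : Prop :=
  (∀ i j : Fin n, i ≠ j → j ≠ i + 1 → i ≠ j + 1 → A i j = 0) ∧
  (∀ i : Fin n, A i (i + 1) ≠ 0 ∨ A (i + 1) i ≠ 0)

/-- For a cycle-form pattern, `D(A_+)` contains a directed cycle of length `n`. -/
def PlusNCycle {n : ℕ} [NeZero n] (A : Matrix (Fin n) (Fin n) SignType) : Prop :=
  (∀ i : Fin n, A i (i + 1) = 1) ∨ (∀ i : Fin n, A (i + 1) i = 1)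

/-- For a cycle-form pattern, `D(A_-)` contains a directed cycle of length `n`. -/
def MinusNCycle {n : ℕ} [NeZero n] (A : Matrix (Fin n) (Fin n) SignType) : Prop :=
  (∀ i : Fin n, A i (i + 1) = -1) ∨ (∀ i : Fin n, A (i + 1) i = -1)

/-- Polynomials in `M` inherit a vanishing block of `M` with rows outside `S` and columns
inside `S`. -/
lemma aeval_apply_eq_zero_of_block {ι : Type*} [Fintype ι] [DecidableEq ι]
    (M : Matrix ι ι ℝ) (S : ι → Prop) (hM : ∀ x y, ¬ S x → S y → M x y = 0)
    (f : Polynomial ℝ) {x y : ι} (hx : ¬ S x) (hy : S y) :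
    Polynomial.aeval M f x y = 0 := by
  have hpow : ∀ k : ℕ, ∀ x y, ¬ S x → S y → (M ^ k) x y = 0 := by
    intro k
    induction k with
    | zero =>
      intro x y hx hy
      rw [pow_zero, Matrix.one_apply_ne]
      rintro rfl
      exact hx hy
    | succ k ih =>
      intro x y hx hy
      rw [pow_succ, Matrix.mul_apply]
      refine Finset.sum_eq_zero fun z _ => ?_
      by_cases hz : S z
      · rw [ih x z hx hz, zero_mul]
      · rw [hM z y hz hy, mul_zero]
  induction f using Polynomial.induction_on' with
  | add p q hp hq => rw [map_add, Matrix.add_apply, hp, hq, add_zero]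
  | monomial k a =>
    rw [Polynomial.aeval_monomial, ← Algebra.smul_def, Matrix.smul_apply, hpow k x y hx hy,
      smul_zero]

/-- If `N` commutes with `M`, then the commutator of `M` with a diagonal matrix is orthogonal
to the transpose of `N`. -/
lemma sum_commutator_diagonal_mul_eq_zero {ι : Type*} [Fintype ι] [DecidableEq ι]
    {M N : Matrix ι ι ℝ} (hMN : Commute M N) (d : ι → ℝ) :
    ∑ x, ∑ y, (d x - d y) * M x y * N y x = 0 := by
  have h : (diagonal d * (M * N)).trace = (diagonal d * (N * M)).trace := by rw [hMN.eq]
  have h₁ : (diagonal d * (M * N)).trace = ∑ x, ∑ y, d x * M x y * N y x := by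
    simp only [Matrix.trace, Matrix.diag_apply, Matrix.diagonal_mul]
    simp only [Matrix.mul_apply, Finset.mul_sum, mul_assoc]
  have h₂ : (diagonal d * (N * M)).trace = ∑ x, ∑ y, d y * M x y * N y x := by
    rw [Finset.sum_comm]
    simp only [Matrix.trace, Matrix.diag_apply, Matrix.diagonal_mul]
    simp only [Matrix.mul_apply, Finset.mul_sum]
    exact Finset.sum_congr rfl fun x _ => Finset.sum_congr rfl fun y _ => by ring
  simp only [sub_mul, Finset.sum_sub_distrib]
  rw [← h₁, ← h₂, h, sub_self]

/-- A matrix whose entries leaving `S` are nonnegative, whose entries entering `S` are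
nonpositive, and which has a nonzero entry of one of these kinds, is not algebraically
positive. -/
lemma not_algPositive_of_signed_cut {n : ℕ} (M : Matrix (Fin n) (Fin n) ℝ) (S : Fin n → Prop)
    (hout : ∀ x y, S x → ¬ S y → 0 ≤ M x y) (hin : ∀ x y, ¬ S x → S y → M x y ≤ 0)
    (hne : ∃ x y, ¬ (S x ↔ S y) ∧ M x y ≠ 0) : ¬ AlgPositive M := by
  classical
  rintro ⟨f, hf⟩
  have hcomm : Commute M (Polynomial.aeval M f) := by
    have h := (Commute.all (Polynomial.X : Polynomial ℝ) f).map (Polynomial.aeval M)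
    rwa [Polynomial.aeval_X] at h
  have hsum := sum_commutator_diagonal_mul_eq_zero hcomm (fun x => if S x then 1 else 0)
  have hnonneg : ∀ x y, 0 ≤ ((if S x then 1 else 0) - (if S y then 1 else 0)) * M x y *
      Polynomial.aeval M f y x := by
    intro x y
    refine mul_nonneg ?_ (hf y x).le
    by_cases hx : S x <;> by_cases hy : S y <;> simp [hx, hy]
    · exact hout x y hx hy
    · exact hin x y hx hy
  obtain ⟨x, y, hxy, hM⟩ := hne
  rw [Finset.sum_eq_zero_iff_of_nonneg
    fun x _ => Finset.sum_nonneg fun y _ => hnonneg x y] at hsum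
  have hx := hsum x (Finset.mem_univ x)
  rw [Finset.sum_eq_zero_iff_of_nonneg fun y _ => hnonneg x y] at hx
  have hzero := hx y (Finset.mem_univ y)
  have hN := (hf y x).ne'
  by_cases hx : S x <;> by_cases hy : S y <;> simp_all

/-- Removing two edges of a cycle leaves an arc: the only step entering it is at `i` and the only
step leaving it is at `j`. -/
lemma exists_cyclic_arc {n : ℕ} [NeZero n] {i j : Fin n} (hij : i ≠ j) :
    ∃ S : Fin n → Prop, ¬ S i ∧ S (i + 1) ∧ S j ∧ ¬ S (j + 1) ∧
      (∀ x, ¬ S x → S (x + 1) → x = i) ∧ (∀ x, S x → ¬ S (x + 1) → x = j) := by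
  have hsucc : ∀ x : Fin n, (x + 1).val = if x.val + 1 = n then 0 else x.val + 1 := by
    intro x
    rw [Fin.val_add, Fin.val_one', Nat.add_mod_mod]
    split_ifs with h
    · rw [h, Nat.mod_self]
    · exact Nat.mod_eq_of_lt (by omega)
  have hij' : i.val ≠ j.val := fun h => hij (Fin.ext h)
  refine ⟨fun x => if i.val < j.val then i.val < x.val ∧ x.val ≤ j.val
    else x.val ≤ j.val ∨ i.val < x.val, ?_, ?_, ?_, ?_, ?_, ?_⟩
  all_goals
    simp only [hsucc, Fin.ext_iff]
    intros
    split_ifs at * <;> omega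

/-- Every sign pattern has a nonempty qualitative class. -/
lemma exists_inQClass {n : ℕ} (A : Matrix (Fin n) (Fin n) SignType) :
    ∃ B : Matrix (Fin n) (Fin n) ℝ, InQClass A B := by
  refine ⟨fun x y => (A x y : ℝ), fun x y => ?_⟩
  cases h : A x y <;> simp [h]

/-- For a cycle-form sign pattern requiring algebraic positivity:
(1) there are no `i, j` with `a_{i,i+1} = 0` and `a_{j+1,j} = 0`; (2) there are no
`i, j` with `a_{i,i+1} ∈ {-,0}`, `a_{i+1,i} ∈ {+,0}`, `a_{j+1,j} ∈ {-,0}`,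
`a_{j,j+1} ∈ {+,0}`. -/
theorem stmt_5 {n : ℕ} [NeZero n] (hn : 3 ≤ n) (A : Matrix (Fin n) (Fin n) SignType)
    (hcyc : CycleForm A) (hreq : RequiresAP A) :
    (¬ ∃ i j : Fin n, A i (i + 1) = 0 ∧ A (j + 1) j = 0) ∧
    (¬ ∃ i j : Fin n, A i (i + 1) ≠ 1 ∧ A (i + 1) i ≠ -1 ∧
        A (j + 1) j ≠ 1 ∧ A j (j + 1) ≠ -1) := by
  obtain ⟨B, hB⟩ := exists_inQClass A
  have hAP := hreq B hB
  obtain ⟨hoff, hedge⟩ := hcyc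
  have hzero : ∀ {x y}, A x y = 0 → B x y = 0 := fun h => sign_eq_zero_iff.1 ((hB _ _).trans h)
  have hnonpos : ∀ {x y}, A x y ≠ 1 → B x y ≤ 0 := fun h =>
    not_lt.1 fun hpos => h ((hB _ _).symm.trans (sign_pos hpos))
  have hnonneg : ∀ {x y}, A x y ≠ -1 → 0 ≤ B x y := fun h =>
    not_lt.1 fun hneg => h ((hB _ _).symm.trans (sign_neg hneg))
  constructor
  · rintro ⟨i, j, hi, hj⟩
    have hij : i ≠ j := by
      rintro rfl
      exact (hedge i).elim (· hi) (· hj)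
    obtain ⟨S, hSi, -, hSj, -, henter, hleave⟩ := exists_cyclic_arc hij
    obtain ⟨f, hf⟩ := hAP
    refine (hf i j).ne' (aeval_apply_eq_zero_of_block B S (fun x y hx hy => hzero ?_) f hSi hSj)
    by_cases h₁ : y = x + 1
    · subst h₁
      rwa [henter x hx hy]
    by_cases h₂ : x = y + 1
    · subst h₂
      rwa [hleave y hy hx]
    · exact hoff x y (by rintro rfl; exact hx hy) h₁ h₂
  · rintro ⟨i, j, hi, hi', hj, hj'⟩
    have hij : i ≠ j := by
      rintro rfl
      have h := hedge i
      revert h hi hi' hj hj'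
      generalize A i (i + 1) = a
      generalize A (i + 1) i = b
      revert a b
      decide
    obtain ⟨S, hSi, hSi', -, -, henter, hleave⟩ := exists_cyclic_arc hij
    refine not_algPositive_of_signed_cut B S (fun x y hx hy => ?_) (fun x y hx hy => ?_) ?_ hAP
    · refine hnonneg ?_
      by_cases h₁ : y = x + 1
      · subst h₁
        rwa [hleave x hx hy]
      by_cases h₂ : x = y + 1
      · subst h₂
        rwa [henter y hy hx]
      · rw [hoff x y (by rintro rfl; exact hy hx) h₁ h₂]
        decide
    · refine hnonpos ?_
      by_cases h₁ : y = x + 1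
      · subst h₁
        rwa [henter x hx hy]
      by_cases h₂ : x = y + 1
      · subst h₂
        rwa [hleave y hy hx]
      · rw [hoff x y (by rintro rfl; exact hx hy) h₁ h₂]
        decide
    · have hne : ∀ {x y}, A x y ≠ 0 → B x y ≠ 0 := fun h h' =>
        h ((hB _ _).symm.trans (sign_eq_zero_iff.2 h'))
      rcases hedge i with h | h
      · exact ⟨i, i + 1, by tauto, hne h⟩
      · exact ⟨i + 1, i, by tauto, hne h⟩
end

section
/- Let A be an n×n sign pattern of cycle form. If A requires algebraic positivity, then either D(A_+) or D(A_-) contains a directed cycle of length n; equivalently, one of the following four conditions holds (indices modulo n): a_{i,i+1} = + for all i, or a_{i+1,i} = + for all i, or a_{i,i+1} = - for all i, or a_{i+1,i} = - for all i. -/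
open Matrix

lemma mulVec_pos_of_pos {ι : Type*} [Fintype ι] {C : Matrix ι ι ℝ} (hC : ∀ i j, 0 < C i j)
    {x : ι → ℝ} (hx : ∀ i, 0 ≤ x i) (hx0 : x ≠ 0) (i : ι) : 0 < (C *ᵥ x) i := by
  obtain ⟨j, hj⟩ := Function.ne_iff.mp hx0
  exact Finset.sum_pos' (fun k _ => mul_nonneg (hC i k).le (hx k))
    ⟨j, Finset.mem_univ j, mul_pos (hC i j) (lt_of_le_of_ne (hx j) (Ne.symm hj))⟩

/-- Perron theorem: an entrywise positive matrix has a positive eigenvector. The eigenvalue maximizes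
the Collatz–Wielandt ratio over the image of the standard simplex. -/
lemma exists_pos_eigenvector {ι : Type*} [Fintype ι] [Nonempty ι] {C : Matrix ι ι ℝ}
    (hC : ∀ i j, 0 < C i j) : ∃ (ρ : ℝ) (x : ι → ℝ), (∀ i, 0 < x i) ∧ C *ᵥ x = ρ • x := by
  classical
  have hne : (Finset.univ : Finset ι).Nonempty := Finset.univ_nonempty
  have hsimp : ∀ z ∈ stdSimplex ℝ ι, ∀ i, 0 < (C *ᵥ z) i := by
    intro z hz
    refine mulVec_pos_of_pos hC hz.1 ?_
    rintro rfl
    simpa using hz.2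
  let g : (ι → ℝ) → ℝ := fun z =>
    Finset.univ.inf' hne fun i => (C *ᵥ (C *ᵥ z)) i / (C *ᵥ z) i
  have hg : ContinuousOn g (stdSimplex ℝ ι) := by
    refine ContinuousOn.finset_inf'_apply hne fun i _ => ?_
    refine ContinuousOn.div ?_ ?_ fun z hz => (hsimp z hz i).ne'
    · exact Continuous.continuousOn (by fun_prop)
    · exact Continuous.continuousOn (by fun_prop)
  have hsne : (stdSimplex ℝ ι).Nonempty :=
    ⟨_, single_mem_stdSimplex ℝ (Classical.arbitrary ι)⟩
  obtain ⟨z, hz, hmax⟩ := (isCompact_stdSimplex ℝ ι).exists_isMaxOn hsne hg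
  have hx := hsimp z hz
  set x := C *ᵥ z with hxdef
  refine ⟨g z, x, hx, ?_⟩
  by_contra hneq
  have hle : ∀ i, 0 ≤ (C *ᵥ x - g z • x) i := by
    intro i
    have h1 : g z ≤ (C *ᵥ x) i / x i := Finset.inf'_le _ (Finset.mem_univ i)
    have h2 := (le_div_iff₀ (hx i)).mp h1
    simpa using h2
  have hgt := mulVec_pos_of_pos hC hle (sub_ne_zero.mpr hneq)
  have hs : 0 < ∑ i, x i := Finset.sum_pos (fun i _ => hx i) hne
  have hz' : (∑ i, x i)⁻¹ • x ∈ stdSimplex ℝ ι := by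
    refine ⟨fun i => ?_, ?_⟩
    · exact mul_nonneg (inv_nonneg.mpr hs.le) (hx i).le
    · simp only [Pi.smul_apply, smul_eq_mul, ← Finset.mul_sum]
      exact inv_mul_cancel₀ hs.ne'
  have hlt : g z < g ((∑ i, x i)⁻¹ • x) := by
    refine (Finset.lt_inf'_iff hne).mpr fun i _ => ?_
    have hp := hsimp _ hz' i
    rw [lt_div_iff₀ hp]
    have h := hgt i
    rw [mulVec_sub, mulVec_smul] at h
    simp only [Pi.sub_apply, Pi.smul_apply, smul_eq_mul, mulVec_smul] at h ⊢
    have := mul_pos (inv_pos.mpr hs) h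
    linarith
  exact absurd (hmax hz') (not_le.mpr hlt)

/-- A positive eigenvector of a positive matrix spans its eigenspace. -/
lemma eigenvector_eq_smul_of_pos {ι : Type*} [Fintype ι] [Nonempty ι] {C : Matrix ι ι ℝ}
    (hC : ∀ i j, 0 < C i j) {ρ : ℝ} {x z : ι → ℝ} (hx : ∀ i, 0 < x i) (hCx : C *ᵥ x = ρ • x)
    (hCz : C *ᵥ z = ρ • z) : ∃ t : ℝ, z = t • x := by
  obtain ⟨i, hi⟩ := Finite.exists_min fun i => z i / x i
  refine ⟨z i / x i, ?_⟩
  by_contra hne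
  have hle : ∀ j, 0 ≤ (z - (z i / x i) • x) j := by
    intro j
    have := (le_div_iff₀ (hx j)).mp (hi j)
    simpa using this
  have h := mulVec_pos_of_pos hC hle (sub_ne_zero.mpr hne) i
  rw [mulVec_sub, mulVec_smul, hCx, hCz] at h
  have hxi := (hx i).ne'
  simp only [Pi.sub_apply, Pi.smul_apply, smul_eq_mul] at h
  have h0 : ρ * z i - z i / x i * (ρ * x i) = 0 := by
    field_simp
    ring
  linarith

/-- An algebraically positive matrix has a positive eigenvector. -/
lemma AlgPositive.exists_pos_eigenvector {n : ℕ} [NeZero n] {M : Matrix (Fin n) (Fin n) ℝ}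
    (hM : AlgPositive M) :
    ∃ (μ : ℝ) (x : Fin n → ℝ), (∀ i, 0 < x i) ∧ M *ᵥ x = μ • x := by
  obtain ⟨f, hf⟩ := hM
  obtain ⟨ρ, x, hx, hCx⟩ := _root_.exists_pos_eigenvector hf
  have hcomm : Polynomial.aeval M f * M = M * Polynomial.aeval M f := by
    have h := congrArg (Polynomial.aeval M) (mul_comm f Polynomial.X)
    simpa using h
  obtain ⟨t, ht⟩ := eigenvector_eq_smul_of_pos hf hx hCx (z := M *ᵥ x) (by
    rw [mulVec_mulVec, hcomm, ← mulVec_mulVec, hCx, mulVec_smul])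
  exact ⟨t, x, hx, ht⟩

/-- The matrices supported on arcs that do not leave `S` are closed under polynomials, so an
algebraically positive matrix has no proper nonempty closed vertex set. -/
lemma not_algPositive_of_closed {n : ℕ} {M : Matrix (Fin n) (Fin n) ℝ} {S : Set (Fin n)}
    (hS : ∀ u ∈ S, ∀ v ∉ S, M u v = 0) {a b : Fin n} (ha : a ∈ S) (hb : b ∉ S) :
    ¬ AlgPositive M := by
  rintro ⟨f, hf⟩
  have hpow : ∀ m : ℕ, ∀ u ∈ S, ∀ v ∉ S, (M ^ m) u v = 0 := by
    intro m
    induction m with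
    | zero =>
      intro u hu v hv
      rw [pow_zero, one_apply_ne]
      rintro rfl
      exact hv hu
    | succ m ih =>
      intro u hu v hv
      rw [pow_succ, mul_apply]
      refine Finset.sum_eq_zero fun w _ => ?_
      by_cases hw : w ∈ S
      · rw [hS w hw v hv, mul_zero]
      · rw [ih u hu w hw, zero_mul]
  have h := hf a b
  rw [Polynomial.aeval_eq_sum_range, Matrix.sum_apply] at h
  refine h.ne' (Finset.sum_eq_zero fun m _ => ?_)
  rw [Matrix.smul_apply, hpow m a ha b hb, smul_zero]

lemma sign_mul_signType_cast {c : ℝ} (hc : 0 < c) (s : SignType) :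
    SignType.sign (c * (s : ℝ)) = s := by
  cases s <;> simp [hc]

lemma abs_signType_cast_le_one (s : SignType) : |(s : ℝ)| ≤ 1 := by
  cases s <;> simp

/-- If a pattern requiring algebraic positivity contains a spanning directed cycle, given by its
successor map `σ`, then all arcs of that cycle have the same sign: otherwise make all other
entries so small that no positive eigenvector survives. -/
lemma RequiresAP.cycle_sign_const {n : ℕ} [NeZero n] {A : Matrix (Fin n) (Fin n) SignType}
    (hreq : RequiresAP A) (σ : Fin n → Fin n) (hσ : ∀ i j, ∃ k < n, σ^[k] i = j)
    (hne : ∀ i, A i (σ i) ≠ 0) :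
    (∀ i, A i (σ i) = 1) ∨ (∀ i, A i (σ i) = -1) := by
  by_contra! hcon
  obtain ⟨⟨a, ha⟩, ⟨b, hb⟩⟩ := hcon
  have ha' : A a (σ a) = -1 := by
    have := hne a
    revert ha this; cases A a (σ a) <;> simp
  have hb' : A b (σ b) = 1 := by
    have := hne b
    revert hb this; cases A b (σ b) <;> simp
  have hn : (0 : ℝ) < n := by exact_mod_cast Nat.pos_of_ne_zero (NeZero.ne n)
  set δ : ℝ := (1 / 4) ^ n with hδ
  have hδ0 : 0 < δ := by positivity
  have hδ1 : δ ≤ 1 := pow_le_one₀ (by norm_num) (by norm_num)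
  let B : Matrix (Fin n) (Fin n) ℝ := fun i j =>
    (if j = σ i then 1 else δ / n) * (A i j : ℝ)
  have hB : InQClass A B := by
    intro i j
    refine sign_mul_signType_cast ?_ _
    split_ifs <;> positivity
  obtain ⟨μ, x, hx, hBx⟩ := (hreq B hB).exists_pos_eigenvector
  obtain ⟨m, hm⟩ := Finite.exists_max x
  have hclose : ∀ i, |μ * x i - (A i (σ i) : ℝ) * x (σ i)| ≤ δ * x m := by
    intro i
    have h1 : μ * x i = ∑ j, B i j * x j := by
      have := congrFun hBx i
      simpa [mulVec, dotProduct] using this.symm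
    rw [h1, ← Finset.add_sum_erase _ _ (Finset.mem_univ (σ i))]
    have h2 : B i (σ i) = (A i (σ i) : ℝ) := by simp [B]
    rw [h2, add_sub_cancel_left]
    have hterm : ∀ j ∈ Finset.univ.erase (σ i), |B i j * x j| ≤ δ / n * x m := by
      intro j hj
      have hj' := Finset.ne_of_mem_erase hj
      simp only [B, hj', if_false, abs_mul, abs_of_pos (hx j), abs_of_pos (div_pos hδ0 hn)]
      have h3 := abs_signType_cast_le_one (A i j)
      have h4 : 0 < δ / n := div_pos hδ0 hn
      have h5 : δ / n * |(A i j : ℝ)| ≤ δ / n := mul_le_of_le_one_right h4.le h3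
      exact mul_le_mul h5 (hm j) (hx j).le h4.le
    calc |∑ j ∈ Finset.univ.erase (σ i), B i j * x j|
        ≤ ∑ j ∈ Finset.univ.erase (σ i), |B i j * x j| := Finset.abs_sum_le_sum_abs _ _
      _ ≤ ∑ j ∈ Finset.univ.erase (σ i), δ / n * x m := Finset.sum_le_sum hterm
      _ ≤ ∑ _j : Fin n, δ / n * x m :=
          Finset.sum_le_sum_of_subset_of_nonneg (Finset.erase_subset _ _)
            fun _ _ _ => (mul_pos (div_pos hδ0 hn) (hx m)).le
      _ = δ * x m := by
          rw [Finset.sum_const, Finset.card_univ, Fintype.card_fin, nsmul_eq_mul]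
          field_simp
  have habs : ∀ i, |(A i (σ i) : ℝ) * x (σ i)| = x (σ i) := by
    intro i
    rw [abs_mul, abs_of_pos (hx _)]
    have := hne i
    revert this; cases A i (σ i) <;> simp
  have hμ : |μ| ≤ 2 := by
    have h1 : |μ| * x m ≤ 2 * x m := by
      rw [← abs_of_pos (hx m), ← abs_mul, abs_of_pos (hx m)]
      have h2 := abs_sub_abs_le_abs_sub (μ * x m) ((A m (σ m) : ℝ) * x (σ m))
      rw [habs] at h2
      nlinarith [hclose m, hm (σ m), hx m]
    exact le_of_mul_le_mul_right h1 (hx m)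
  have hstep : ∀ i, x (σ i) ≤ 2 * x i + δ * x m := by
    intro i
    have h2 := abs_sub_abs_le_abs_sub ((A i (σ i) : ℝ) * x (σ i)) (μ * x i)
    rw [habs, abs_sub_comm, abs_mul, abs_of_pos (hx i)] at h2
    nlinarith [hclose i, hx i]
  obtain ⟨j, hj⟩ : ∃ j, x (σ j) ≤ δ * x m := by
    rcases le_total 0 μ with h | h
    · refine ⟨a, ?_⟩
      have h1 := (abs_le.mp (hclose a)).2
      have h2 := mul_nonneg h (hx a).le
      rw [ha'] at h1
      simp at h1
      linarith
    · refine ⟨b, ?_⟩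
      have h1 := (abs_le.mp (hclose b)).1
      have h2 := mul_nonneg (neg_nonneg.mpr h) (hx b).le
      rw [hb'] at h1
      simp at h1
      linarith
  have hiter : ∀ k : ℕ, x (σ^[k] (σ j)) ≤ 3 ^ k * (δ * x m) := by
    intro k
    induction k with
    | zero => simpa using hj
    | succ k ih =>
      rw [Function.iterate_succ_apply']
      have h1 := hstep (σ^[k] (σ j))
      have h2 : (1 : ℝ) ≤ 3 ^ k := one_le_pow₀ (by norm_num)
      have h3 := mul_le_mul_of_nonneg_right h2 (mul_pos hδ0 (hx m)).le
      rw [pow_succ]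
      linarith
  obtain ⟨k, hk, hkm⟩ := hσ (σ j) m
  have h1 := hiter k
  rw [hkm] at h1
  have h2 : (3 : ℝ) ^ k < 4 ^ n :=
    (pow_lt_pow_right₀ (by norm_num) hk).trans_le
      (pow_le_pow_left₀ (by norm_num) (by norm_num) n)
  have h3 : (3 : ℝ) ^ k * δ < 1 := by
    rw [hδ, one_div, inv_pow, ← div_eq_mul_inv, div_lt_one (by positivity)]
    exact h2
  nlinarith [hx m]

open scoped Fin.CommRing in
lemma Fin.nsmul_one_eq_ofNat {n : ℕ} [NeZero n] (k : ℕ) :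
    k • (1 : Fin n) = Fin.ofNat n k :=
  nsmul_one k

lemma Fin.exists_lt_add_nsmul_one {n : ℕ} [NeZero n] (i j : Fin n) :
    ∃ k < n, i + k • (1 : Fin n) = j :=
  ⟨(j - i).val, (j - i).isLt, by
    rw [Fin.nsmul_one_eq_ofNat, Fin.ofNat_val_eq_self, add_sub_cancel]⟩

/-- In a cycle-form pattern requiring algebraic positivity, one of the two orientations of the
cycle is fully present. -/
lemma RequiresAP.forall_ne_zero_or {n : ℕ} [NeZero n] {A : Matrix (Fin n) (Fin n) SignType}
    (hreq : RequiresAP A) (hcyc : CycleForm A) :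
    (∀ i, A i (i + 1) ≠ 0) ∨ (∀ i, A (i + 1) i ≠ 0) := by
  by_contra! hcon
  obtain ⟨⟨i, hi⟩, ⟨j, hj⟩⟩ := hcon
  have hex : ∃ k : ℕ, A (j + 1 + k • 1) (j + 1 + k • 1 + 1) = 0 := by
    obtain ⟨k, -, hk⟩ := Fin.exists_lt_add_nsmul_one (j + 1) i
    exact ⟨k, by rw [hk, hi]⟩
  classical
  have hmin : ∀ k < Nat.find hex, A (j + 1 + k • 1) (j + 1 + k • 1 + 1) ≠ 0 :=
    fun k hk => Nat.find_min hex hk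
  have hpj : A j (j + 1) ≠ 0 := (hcyc.2 j).resolve_right (not_not.mpr hj)
  let S : Set (Fin n) := {u | ∃ k ≤ Nat.find hex, u = j + 1 + k • (1 : Fin n)}
  have hB : InQClass A fun u v => (A u v : ℝ) := by
    intro u v
    simpa using sign_mul_signType_cast one_pos (A u v)
  have hfind : Nat.find hex < n := by
    obtain ⟨k, hk, hki⟩ := Fin.exists_lt_add_nsmul_one (j + 1) i
    exact (Nat.find_min' hex (by rw [hki, hi])).trans_lt hk
  refine not_algPositive_of_closed (S := S) (a := j + 1) (b := j) ?_ ⟨0, by simp⟩ ?_ (hreq _ hB)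
  · rintro u ⟨k, hk, rfl⟩ v hv
    suffices A (j + 1 + k • 1) v = 0 by simp [this]
    have hvne : j + 1 + k • (1 : Fin n) ≠ v := by
      rintro rfl
      exact hv ⟨k, hk, rfl⟩
    by_cases h1 : v = j + 1 + k • 1 + 1
    · rcases hk.eq_or_lt with rfl | hlt
      · rw [h1]
        exact Nat.find_spec hex
      · exact absurd ⟨k + 1, hlt, by rw [h1]; rw [succ_nsmul]; abel⟩ hv
    by_cases h2 : j + 1 + k • (1 : Fin n) = v + 1
    · cases k with
      | zero =>
        have : v = j := by simpa using h2.symm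
        subst this
        simpa using hj
      | succ k =>
        refine absurd ⟨k, by omega, ?_⟩ hv
        have h3 : (j + 1 + k • (1 : Fin n)) + 1 = v + 1 := by
          rw [← h2]; rw [succ_nsmul]; abel
        exact (add_right_cancel h3).symm
    exact hcyc.1 _ _ hvne h1 h2
  · rintro ⟨k, hk, hjk⟩
    rcases hk.eq_or_lt with rfl | hlt
    · have := Nat.find_spec hex
      rw [← hjk] at this
      exact hpj this
    · have h0 : (k + 1) • (1 : Fin n) = 0 := by
        have : j + (k + 1) • (1 : Fin n) = j + 0 := by
          rw [add_zero]; nth_rw 2 [hjk]; rw [succ_nsmul]; abel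
        exact add_left_cancel this
      have hdvd : n ∣ k + 1 :=
        Fin.natCast_eq_zero.mp ((Fin.nsmul_one_eq_ofNat _).symm.trans h0)
      have := Nat.le_of_dvd (Nat.succ_pos k) hdvd
      omega

/-- A cycle-form sign pattern requiring algebraic positivity has a
directed `n`-cycle in `D(A_+)` or in `D(A_-)`. -/
theorem stmt_6 {n : ℕ} [NeZero n] (hn : 3 ≤ n) (A : Matrix (Fin n) (Fin n) SignType)
    (hcyc : CycleForm A) (hreq : RequiresAP A) :
    (∀ i : Fin n, A i (i + 1) = 1) ∨ (∀ i : Fin n, A (i + 1) i = 1) ∨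
    (∀ i : Fin n, A i (i + 1) = -1) ∨ (∀ i : Fin n, A (i + 1) i = -1) := by
  have hiter : ∀ (s i : Fin n) (k : ℕ), (· + s)^[k] i = i + k • s := by
    intro s i k
    induction k with
    | zero => simp
    | succ k ih => rw [Function.iterate_succ_apply', ih, succ_nsmul, add_assoc]
  rcases hreq.forall_ne_zero_or hcyc with h | h
  · have hσ : ∀ i j : Fin n, ∃ k < n, (· + 1)^[k] i = j := by
      intro i j
      obtain ⟨k, hk, hkj⟩ := Fin.exists_lt_add_nsmul_one i j
      exact ⟨k, hk, by rw [hiter, hkj]⟩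
    rcases hreq.cycle_sign_const _ hσ h with h | h
    · exact .inl h
    · exact .inr (.inr (.inl h))
  · have hσ : ∀ i j : Fin n, ∃ k < n, (· + -1)^[k] i = j := by
      intro i j
      obtain ⟨k, hk, hkj⟩ := Fin.exists_lt_add_nsmul_one j i
      exact ⟨k, hk, by rw [hiter, ← hkj, smul_neg, add_neg_cancel_right]⟩
    rcases hreq.cycle_sign_const _ hσ (fun i => by simpa using h (i + -1)) with h | h
    · exact .inr (.inl fun i => by simpa using h (i + 1))
    · exact .inr (.inr (.inr fun i => by simpa using h (i + 1)))
end

section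
/- Let A be an n×n sign non-singular (SNS) sign pattern matrix and let r and s be distinct indices with 1 ≤ r, s ≤ n. The entries in the (s,r)-position of the matrices in {adj(B) : B ∈ Q(A)} all have the same sign (a single element of {+, -, 0} independent of the choice of B ∈ Q(A)) if and only if the quantity (−1)^l · sign(α) · sign(β) is the same for every directed path α from s to r in D(A) and every nonzero term β of the standard determinant expansion of the sign pattern A(α) obtained from A by deleting the rows and columns indexed by the vertices covered by α, where l denotes the length of α (when α covers all n vertices, the unique term β is the empty product, of sign +). -/
open Matrix

/-- A sign pattern is sign non-singular if every matrix in its qualitative class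
has nonzero determinant. -/
def IsSNS {n : ℕ} (A : Matrix (Fin n) (Fin n) SignType) : Prop :=
  ∀ B : Matrix (Fin n) (Fin n) ℝ, InQClass A B → B.det ≠ 0
/-- `l` is (the vertex list of) a directed path from `s` to `r` in `D(A)`:
a list of distinct vertices, starting at `s`, ending at `r`, whose consecutive
pairs are arcs of `D(A)`. -/
def IsDPath {n : ℕ} (A : Matrix (Fin n) (Fin n) SignType) (s r : Fin n)
    (l : List (Fin n)) : Prop :=
  l.Nodup ∧ l.head? = some s ∧ l.getLast? = some r ∧
    l.Chain' (fun i j => A i j ≠ 0)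

/-- The sign of a directed path: the product of the signs of its arcs. -/
def pathSign {n : ℕ} (A : Matrix (Fin n) (Fin n) SignType) (l : List (Fin n)) : SignType :=
  ((l.zip l.tail).map fun p => A p.1 p.2).prod

/-- The length of a path given by its vertex list. -/
def pathLength {n : ℕ} (l : List (Fin n)) : ℕ := l.length - 1

/-- Conversion of a permutation sign (a unit of `ℤ`) to a `SignType`. -/
def unitsToSign (u : ℤˣ) : SignType := if u = 1 then 1 else -1

/-- The sign of the term of the standard determinant expansion of the sign pattern
obtained from `A` by deleting the rows and columns indexed by the vertices of `l`,
corresponding to the permutation `σ`.  (It is nonzero exactly when the term is a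
nonzero term; when `l` covers all vertices the unique term is the empty product,
of sign `+`.) -/
def termSign {n : ℕ} (A : Matrix (Fin n) (Fin n) SignType) (l : List (Fin n))
    (σ : Equiv.Perm {i : Fin n // i ∉ l}) : SignType :=
  unitsToSign (Equiv.Perm.sign σ) * ∏ i : {i : Fin n // i ∉ l}, A i.val (σ i).val

/-- The sign of a permutation, as a sign, is multiplicative. -/
theorem unitsToSign_mul (u v : ℤˣ) : unitsToSign (u * v) = unitsToSign u * unitsToSign v := by
  rcases Int.units_eq_one_or u with rfl | rfl <;> rcases Int.units_eq_one_or v with rfl | rfl <;>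
    decide

theorem unitsToSign_neg_one_pow (k : ℕ) : unitsToSign ((-1) ^ k) = (-1 : SignType) ^ k := by
  induction k with
  | zero => decide
  | succ k ih => rw [pow_succ, unitsToSign_mul, ih, pow_succ]; rfl

theorem sign_intCast_units (u : ℤˣ) : SignType.sign (((u : ℤ) : ℝ)) = unitsToSign u := by
  rcases Int.units_eq_one_or u with rfl | rfl <;> simp [unitsToSign]

theorem sign_realCast_signType (a : SignType) : SignType.sign (a : ℝ) = a := by
  cases a <;> simp

/-- The sign of the cyclic permutation along a list without repetitions. -/
theorem sign_formPerm {α : Type*} [DecidableEq α] [Fintype α] :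
    ∀ l : List α, l.Nodup → Equiv.Perm.sign l.formPerm = (-1) ^ (l.length - 1)
  | [], _ => by simp
  | [x], _ => by simp
  | x :: y :: l, h => by
    have hxy : x ≠ y := by
      rintro rfl
      simp at h
    rw [List.formPerm_cons_cons, Equiv.Perm.sign_mul, Equiv.Perm.sign_swap hxy,
      sign_formPerm (y :: l) (List.nodup_cons.mp h).2]
    simp [pow_succ]

/-- A sum of reals whose signs are zero or `ε`, with `ε` attained, has sign `ε`. -/
theorem sign_sum_eq {ι : Type*} (t : Finset ι) (f : ι → ℝ) (ε : SignType)
    (h : ∀ i ∈ t, SignType.sign (f i) = 0 ∨ SignType.sign (f i) = ε)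
    (hex : ∃ i ∈ t, SignType.sign (f i) = ε) : SignType.sign (∑ i ∈ t, f i) = ε := by
  obtain ⟨i, hi, hε⟩ := hex
  cases ε with
  | zero =>
    change ∀ i ∈ t, SignType.sign (f i) = 0 ∨ SignType.sign (f i) = 0 at h
    simp only [or_self, sign_eq_zero_iff] at h
    simp [Finset.sum_eq_zero h]
  | pos =>
    change SignType.sign (f i) = 1 at hε
    change SignType.sign _ = 1
    rw [sign_eq_one_iff] at hε ⊢
    refine Finset.sum_pos' (fun j hj => ?_) ⟨i, hi, hε⟩
    rcases h j hj with h | h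
    · exact (sign_eq_zero_iff.mp h).ge
    · exact (sign_eq_one_iff.mp h).le
  | neg =>
    change SignType.sign (f i) = -1 at hε
    change SignType.sign _ = -1
    rw [sign_eq_neg_one_iff] at hε ⊢
    refine Finset.sum_neg' (fun j hj => ?_) ⟨i, hi, hε⟩
    rcases h j hj with h | h
    · exact (sign_eq_zero_iff.mp h).le
    · exact (sign_eq_neg_one_iff.mp h).le

/-- The entry `(s, r)` of the adjugate as a sum over the permutations sending `r` to `s`. -/
theorem adjugate_apply_eq_sum {n : ℕ} (B : Matrix (Fin n) (Fin n) ℝ) (r s : Fin n) :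
    B.adjugate s r = ∑ τ : Equiv.Perm (Fin n) with τ r = s,
      ((Equiv.Perm.sign τ : ℤ) : ℝ) * ∏ i ∈ Finset.univ.erase r, B i (τ i) := by
  rw [adjugate_apply, ← det_transpose, det_apply', Finset.sum_filter]
  refine Finset.sum_congr rfl fun τ _ => ?_
  rw [← Finset.mul_prod_erase _ _ (Finset.mem_univ r)]
  have h : ∀ i ∈ Finset.univ.erase r,
      (B.updateRow r (Pi.single s 1))ᵀ (τ i) i = B i (τ i) := fun i hi => by
    rw [transpose_apply, updateRow_ne (Finset.ne_of_mem_erase hi)]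
  rw [Finset.prod_congr rfl h, transpose_apply, updateRow_self, Pi.single_apply]
  split_ifs <;> simp

/-- The sign of the contribution of `τ` to the entry `(τ r, r)` of the adjugate. -/
def adjTermSign {n : ℕ} (A : Matrix (Fin n) (Fin n) SignType) (r : Fin n)
    (τ : Equiv.Perm (Fin n)) : SignType :=
  unitsToSign (Equiv.Perm.sign τ) * ∏ i ∈ Finset.univ.erase r, A i (τ i)

theorem sign_adjugate_term {n : ℕ} {A : Matrix (Fin n) (Fin n) SignType}
    {B : Matrix (Fin n) (Fin n) ℝ} (r : Fin n) (τ : Equiv.Perm (Fin n))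
    (h : ∀ i, SignType.sign (B i (τ i)) = A i (τ i)) :
    SignType.sign (((Equiv.Perm.sign τ : ℤ) : ℝ) * ∏ i ∈ Finset.univ.erase r, B i (τ i)) =
      adjTermSign A r τ := by
  have hp : SignType.sign (∏ i ∈ Finset.univ.erase r, B i (τ i)) =
      ∏ i ∈ Finset.univ.erase r, SignType.sign (B i (τ i)) :=
    map_prod (signHom : ℝ →*₀ SignType) _ _
  rw [sign_mul, sign_intCast_units, hp, Finset.prod_congr rfl fun i _ => h i, adjTermSign]

/-- Every nonzero term of the adjugate entry prevails for some matrix of the class. -/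
theorem exists_inQClass_sign_adjugate_eq {n : ℕ} (A : Matrix (Fin n) (Fin n) SignType)
    (r : Fin n) (τ : Equiv.Perm (Fin n)) (hτ : adjTermSign A r τ ≠ 0) :
    ∃ B, InQClass A B ∧ SignType.sign (B.adjugate (τ r) r) = adjTermSign A r τ := by
  let B : ℝ → Matrix (Fin n) (Fin n) ℝ := fun x =>
    Matrix.of fun i j => if τ i = j then (A i j : ℝ) else x * (A i j : ℝ)
  have hBc : Continuous fun x => (B x).adjugate (τ r) r := by
    have : Continuous B := by
      refine continuous_matrix fun i j => ?_
      simp only [B, of_apply]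
      split_ifs <;> fun_prop
    exact this.matrix_adjugate.matrix_elem _ _
  have hB0 : SignType.sign ((B 0).adjugate (τ r) r) = adjTermSign A r τ := by
    rw [adjugate_apply_eq_sum, Finset.sum_eq_single τ]
    · exact sign_adjugate_term r τ fun i => by simp [B, sign_realCast_signType]
    · intro σ hσ hne
      obtain ⟨i, hi⟩ := not_forall.mp fun h => hne (Equiv.ext h)
      have hir : i ≠ r := by
        rintro rfl
        exact hi (Finset.mem_filter.mp hσ).2
      rw [Finset.prod_eq_zero (Finset.mem_erase.mpr ⟨hir, Finset.mem_univ i⟩), mul_zero]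
      simp [B, Ne.symm hi]
    · simp
  have hne : (B 0).adjugate (τ r) r ≠ 0 := by
    rw [← sign_ne_zero, hB0]
    exact hτ
  have hev : ∀ᶠ x in nhds (0 : ℝ),
      SignType.sign ((B x).adjugate (τ r) r) = adjTermSign A r τ := by
    have := (continuousAt_sign_of_ne_zero hne).comp (f := fun x => (B x).adjugate (τ r) r)
      hBc.continuousAt
    rw [← hB0]
    exact this.eventually_mem ((isOpen_discrete {SignType.sign _}).mem_nhds rfl)
  obtain ⟨x, hx, hpos⟩ := ((hev.filter_mono nhdsWithin_le_nhds).and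
    (self_mem_nhdsWithin : Set.Ioi (0 : ℝ) ∈ nhdsWithin 0 (Set.Ioi 0))).exists
  refine ⟨B x, fun i j => ?_, hx⟩
  simp only [B, of_apply]
  split_ifs
  · exact sign_realCast_signType _
  · rw [sign_mul, sign_pos hpos, one_mul, sign_realCast_signType]

/-- The sign of a path is a product over its vertices other than the endpoint. -/
theorem pathSign_eq_prod {n : ℕ} (A : Matrix (Fin n) (Fin n) SignType) (l : List (Fin n))
    (hl : l.Nodup) (r : Fin n) (hr : l.getLast? = some r) :
    pathSign A l = ∏ i ∈ l.toFinset.erase r, A i (l.formPerm i) := by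
  have hzip : (l.zip l.tail).map (fun p => A p.1 p.2) =
      l.dropLast.map fun i => A i (l.formPerm i) := by
    refine List.ext_getElem (by simp) fun k h₁ h₂ => ?_
    have hk : k + 1 < l.length := by
      simp at h₂
      omega
    simp [List.formPerm_apply_lt_getElem l hl k hk]
  obtain ⟨m, rfl⟩ := List.getLast?_eq_some_iff.mp hr
  have hset : (m ++ [r]).toFinset.erase r = m.toFinset := by
    ext i
    simp only [List.nodup_append, List.mem_singleton] at hl
    simp only [Finset.mem_erase, List.mem_toFinset, List.mem_append, List.mem_singleton]
    grind
  rw [pathSign, hzip, hset, List.dropLast_concat,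
    List.prod_toFinset _ (List.nodup_append.mp hl).1]

/-- A path from `s` to `r` and a permutation of the uncovered vertices yield a term of the
adjugate entry `(s, r)`. -/
theorem path_quantity_eq_adjTermSign {n : ℕ} (A : Matrix (Fin n) (Fin n) SignType)
    (l : List (Fin n)) (hl : l.Nodup) (r : Fin n) (hr : l.getLast? = some r)
    (σ : Equiv.Perm {i : Fin n // i ∉ l}) :
    (-1 : SignType) ^ pathLength l * pathSign A l * termSign A l σ =
      adjTermSign A r (l.formPerm * Equiv.Perm.ofSubtype σ) := by
  have hin : ∀ i ∈ l, Equiv.Perm.ofSubtype σ i = i := fun i hi =>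
    Equiv.Perm.ofSubtype_apply_of_not_mem σ (not_not.mpr hi)
  have hout : ∀ i : {i : Fin n // i ∉ l},
      (l.formPerm * Equiv.Perm.ofSubtype σ) i = (σ i : Fin n) := fun i => by
    rw [Equiv.Perm.mul_apply, Equiv.Perm.ofSubtype_apply_coe,
      List.formPerm_apply_of_notMem (σ i).2]
  have hsplit : Finset.univ.erase r = l.toFinset.erase r ∪ Finset.univ.filter (· ∉ l) := by
    have hrl := List.mem_of_getLast? hr
    ext i
    simp
    grind
  have hdisj : Disjoint (l.toFinset.erase r) (Finset.univ.filter (· ∉ l)) := by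
    rw [Finset.disjoint_left]
    intro i
    simp
  rw [adjTermSign, hsplit, Finset.prod_union hdisj, Equiv.Perm.sign_mul,
    Equiv.Perm.sign_ofSubtype, unitsToSign_mul, sign_formPerm l hl, unitsToSign_neg_one_pow,
    pathSign_eq_prod A l hl r hr, termSign, pathLength]
  have h₁ : ∏ i ∈ l.toFinset.erase r, A i ((l.formPerm * Equiv.Perm.ofSubtype σ) i) =
      ∏ i ∈ l.toFinset.erase r, A i (l.formPerm i) :=
    Finset.prod_congr rfl fun i hi => by
      rw [Equiv.Perm.mul_apply, hin i (by simpa using Finset.mem_of_mem_erase hi)]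
  have h₂ : ∏ i with i ∉ l, A i ((l.formPerm * Equiv.Perm.ofSubtype σ) i) =
      ∏ i : {i : Fin n // i ∉ l}, A i.val (σ i).val := by
    rw [Finset.prod_subtype (p := (· ∉ l)) _ (by simp)]
    exact Finset.prod_congr rfl fun i _ => by rw [hout]
  rw [h₁, h₂]
  ac_rfl

theorem formPerm_mul_ofSubtype_apply {n : ℕ} {l : List (Fin n)} (hl : l.Nodup) {r s : Fin n}
    (hs : l.head? = some s) (hr : l.getLast? = some r) (σ : Equiv.Perm {i : Fin n // i ∉ l}) :
    (l.formPerm * Equiv.Perm.ofSubtype σ) r = s := by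
  rw [Equiv.Perm.mul_apply, Equiv.Perm.ofSubtype_apply_of_not_mem σ
    (not_not.mpr (List.mem_of_getLast? hr))]
  obtain ⟨m, rfl⟩ := List.head?_eq_some_iff.mp hs
  rw [List.getLast?_eq_some_getLast (List.cons_ne_nil s m), Option.some.injEq] at hr
  rw [← hr, List.formPerm_apply_getLast]

/-- Every nonzero term of the adjugate entry `(s, r)` comes from a path from `s` to `r` and a
permutation of the uncovered vertices. -/
theorem exists_path_of_adjTermSign_ne_zero {n : ℕ} (A : Matrix (Fin n) (Fin n) SignType)
    {r s : Fin n} (hrs : r ≠ s) (τ : Equiv.Perm (Fin n)) (hτ : τ r = s)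
    (hne : adjTermSign A r τ ≠ 0) :
    ∃ l, IsDPath A s r l ∧ ∃ σ : Equiv.Perm {i : Fin n // i ∉ l},
      l.formPerm * Equiv.Perm.ofSubtype σ = τ := by
  have harc : ∀ i, i ≠ r → A i (τ i) ≠ 0 := fun i hi h =>
    hne (by rw [adjTermSign,
      Finset.prod_eq_zero (Finset.mem_erase.mpr ⟨hi, Finset.mem_univ i⟩) h, mul_zero])
  have hsupp : s ∈ τ.support := by
    rw [Equiv.Perm.mem_support]
    intro h
    exact hrs (τ.injective (hτ.trans h.symm))
  have hnd : (τ.toList s).Nodup := Equiv.Perm.nodup_toList τ s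
  have hform : (τ.toList s).formPerm = τ.cycleOf s := Equiv.Perm.formPerm_toList τ s
  have hmem : ∀ i, i ∈ τ.toList s ↔ τ.SameCycle s i := fun i => by
    rw [Equiv.Perm.mem_toList_iff, and_iff_left hsupp]
  have hnil : τ.toList s ≠ [] := List.ne_nil_of_mem ((hmem s).mpr (Equiv.Perm.SameCycle.refl τ s))
  have hhead : (τ.toList s).head? = some s := by
    rw [List.head?_eq_getElem?, List.getElem?_eq_getElem (List.length_pos_iff.mpr hnil),
      Equiv.Perm.getElem_toList]
    simp
  have happ : ∀ i ∈ τ.toList s, (τ.toList s).formPerm i = τ i := fun i hi => by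
    rw [hform, ((hmem i).mp hi).cycleOf_apply]
  have hlast : (τ.toList s).getLast? = some r := by
    obtain ⟨m, hm⟩ := List.head?_eq_some_iff.mp hhead
    have h₁ : (τ.toList s).formPerm ((τ.toList s).getLast hnil) = s := by
      simp only [hm]
      exact List.formPerm_apply_getLast s m
    rw [happ _ (List.getLast_mem hnil)] at h₁
    rw [List.getLast?_eq_some_getLast hnil, τ.injective (h₁.trans hτ.symm)]
  refine ⟨τ.toList s, ⟨hnd, hhead, hlast, ?_⟩, τ.subtypePerm fun i => ?_, ?_⟩
  · refine List.isChain_iff_getElem.mpr fun k hk => ?_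
    have hk' := List.formPerm_apply_lt_getElem _ hnd k hk
    rw [happ _ (List.getElem_mem _)] at hk'
    rw [← hk']
    refine harc _ fun h => ?_
    rw [h, hτ] at hk'
    have h0 : s = (τ.toList s)[0]'(by omega) := by
      rw [Equiv.Perm.getElem_toList]
      simp
    have := (hnd.getElem_inj_iff).mp (h0.symm.trans hk')
    omega
  · rw [hmem, hmem, Equiv.Perm.sameCycle_apply_right]
  · ext1 i
    rw [Equiv.Perm.mul_apply]
    by_cases hi : i ∈ τ.toList s
    · rw [Equiv.Perm.ofSubtype_apply_of_not_mem (p := (· ∉ τ.toList s)) _ (not_not.mpr hi),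
        happ i hi]
    · rw [Equiv.Perm.ofSubtype_apply_of_mem (p := (· ∉ τ.toList s)) _ hi]
      refine List.formPerm_apply_of_notMem ?_
      simpa [hmem] using hi

/-- For an SNS pattern `A` and distinct indices `r, s`, the `(s,r)`
entries of the adjugates of the matrices in `Q(A)` all have one common sign iff the
quantity `(-1)^l · sign(α) · sign(β)` is the same for every directed path `α` from `s`
to `r` in `D(A)` and every nonzero term `β` of the standard determinant expansion of
the pattern obtained by deleting the rows and columns covered by `α`. -/
theorem stmt_9 {n : ℕ} (A : Matrix (Fin n) (Fin n) SignType) (hSNS : IsSNS A)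
    (r s : Fin n) (hrs : r ≠ s) :
    (∃ ε : SignType, ∀ B : Matrix (Fin n) (Fin n) ℝ, InQClass A B →
        SignType.sign (B.adjugate s r) = ε) ↔
    (∃ ε : SignType, ∀ l : List (Fin n), IsDPath A s r l →
        ∀ σ : Equiv.Perm {i : Fin n // i ∉ l}, termSign A l σ ≠ 0 →
          (-1 : SignType) ^ pathLength l * pathSign A l * termSign A l σ = ε) := by
  constructor
  · rintro ⟨ε, hε⟩
    refine ⟨ε, fun l hl σ hσ => ?_⟩
    have hτ := formPerm_mul_ofSubtype_apply hl.1 hl.2.1 hl.2.2.1 σ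
    rw [path_quantity_eq_adjTermSign A l hl.1 r hl.2.2.1 σ]
    have hne : adjTermSign A r (l.formPerm * Equiv.Perm.ofSubtype σ) ≠ 0 := by
      rw [← path_quantity_eq_adjTermSign A l hl.1 r hl.2.2.1 σ]
      refine mul_ne_zero (mul_ne_zero (pow_ne_zero _ (by decide)) ?_) hσ
      refine List.prod_ne_zero fun h => ?_
      obtain ⟨p, hp, h0⟩ := List.mem_map.mp h
      obtain ⟨k, hk, rfl⟩ := List.getElem_of_mem hp
      have hk' : k + 1 < l.length := by
        simp at hk
        omega
      refine List.isChain_iff_getElem.mp hl.2.2.2 k hk' ?_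
      simpa using h0
    obtain ⟨B, hB, hsign⟩ := exists_inQClass_sign_adjugate_eq A r _ hne
    rw [← hsign, hτ, hε B hB]
  · rintro ⟨ε, hε⟩
    have hall : ∀ τ : Equiv.Perm (Fin n), τ r = s → adjTermSign A r τ ≠ 0 →
        adjTermSign A r τ = ε := by
      intro τ hτ hne
      obtain ⟨l, hl, σ, rfl⟩ := exists_path_of_adjTermSign_ne_zero A hrs τ hτ hne
      rw [← path_quantity_eq_adjTermSign A l hl.1 r hl.2.2.1 σ] at hne ⊢
      exact hε l hl σ (right_ne_zero_of_mul hne)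
    by_cases hex : ∃ τ : Equiv.Perm (Fin n), τ r = s ∧ adjTermSign A r τ ≠ 0
    · obtain ⟨τ, hτ, hne⟩ := hex
      refine ⟨ε, fun B hB => ?_⟩
      rw [adjugate_apply_eq_sum]
      refine sign_sum_eq _ _ ε (fun ρ hρ => ?_) ⟨τ, by simpa using hτ, ?_⟩
      · rw [sign_adjugate_term r ρ fun i => hB i (ρ i)]
        exact or_iff_not_imp_left.mpr (hall ρ (Finset.mem_filter.mp hρ).2)
      · rw [sign_adjugate_term r τ fun i => hB i (τ i)]
        exact hall τ hτ hne
    · push Not at hex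
      refine ⟨0, fun B hB => ?_⟩
      rw [adjugate_apply_eq_sum, Finset.sum_eq_zero, sign_zero]
      intro ρ hρ
      rw [← sign_eq_zero_iff, sign_adjugate_term r ρ fun i => hB i (ρ i)]
      exact hex ρ (Finset.mem_filter.mp hρ).2
end

section
/- Let A be an n×n sign pattern of cycle form such that every directed 2-cycle of D(A) is negative and a_{i,i+1} = + for all i (indices modulo n). If A is SNS and a_{ii} ∈ {-, 0} for all i, then A requires algebraic positivity. -/
open Matrix

/-- If each row `i` of a sign non-singular pattern has its only positive entry at position `σ i`,
then every matrix in the qualitative class is monotone. -/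
theorem IsSNS.nonneg_of_mulVec_nonneg {n : ℕ} {A : Matrix (Fin n) (Fin n) SignType}
    (hSNS : IsSNS A) (σ : Equiv.Perm (Fin n)) (hpos : ∀ i, A i (σ i) = 1)
    (hne : ∀ i j, j ≠ σ i → A i j ≠ 1) {B : Matrix (Fin n) (Fin n) ℝ} (hB : InQClass A B)
    {x : Fin n → ℝ} (hx : ∀ i, 0 ≤ (B *ᵥ x) i) (i : Fin n) : 0 ≤ x i := by
  classical
  by_contra! hi
  let Φ : Set (Fin n) →o Set (Fin n) :=
    ⟨fun S => {j | ∃ k ∈ S, A (σ.symm j) k = -1}, fun S T hST j ⟨k, hk, hjk⟩ => ⟨k, hST hk, hjk⟩⟩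
  have hle : {j | x j < 0} ⊆ Φ.gfp := by
    refine Φ.le_gfp fun j hj => ?_
    by_contra hcon
    have hterm : ∀ k ∈ Finset.univ, B (σ.symm j) k * x k ≤ 0 := by
      intro k _
      have hs := hB (σ.symm j) k
      rcases lt_trichotomy (B (σ.symm j) k) 0 with h | h | h
      · rw [sign_neg h] at hs
        have : ¬ x k < 0 := fun hk => hcon ⟨k, hk, hs.symm⟩
        exact mul_nonpos_of_nonpos_of_nonneg h.le (not_lt.mp this)
      · simp [h]
      · rw [sign_pos h] at hs
        have hk : k = j := by
          by_contra hkj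
          exact hne (σ.symm j) k (by simpa using hkj) hs.symm
        subst hk
        exact mul_nonpos_of_nonneg_of_nonpos h.le (le_of_lt hj)
    have hlt : B (σ.symm j) j * x j < 0 := by
      have hs := hB (σ.symm j) j
      have h1 := hpos (σ.symm j)
      rw [Equiv.apply_symm_apply] at h1
      rw [h1, sign_eq_one_iff] at hs
      exact mul_neg_of_pos_of_neg hs hj
    exact (Finset.sum_neg' hterm ⟨j, Finset.mem_univ j, hlt⟩).not_ge (hx (σ.symm j))
  set S := Φ.gfp
  have hfix : ∀ i, σ i ∈ S ↔ ∃ k ∈ S, A i k = -1 := by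
    intro i
    have h : Φ S = S := Φ.map_gfp
    conv_lhs => rw [← h]
    change (∃ k ∈ S, A (σ.symm (σ i)) k = -1) ↔ _
    rw [Equiv.symm_apply_apply]
  let c : Fin n → ℕ := fun i => (Finset.univ.filter fun k => k ∈ S ∧ A i k = -1).card
  let M : Matrix (Fin n) (Fin n) ℝ := fun i j =>
    if j = σ i then (if c i = 0 then 1 else (c i : ℝ)) else ((A i j : SignType) : ℝ)
  have hM : InQClass A M := by
    intro i j
    by_cases hj : j = σ i
    · subst hj
      rw [hpos i, sign_eq_one_iff]
      simp only [M, if_true]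
      split_ifs with h
      · exact one_pos
      · exact_mod_cast Nat.pos_of_ne_zero h
    · simp only [M, if_neg hj]
      cases A i j <;> simp
  let v : Fin n → ℝ := fun j => if j ∈ S then 1 else 0
  have hv : v ≠ 0 := fun h => by
    have := congrFun h i
    simp [v, hle hi] at this
  have hMv : M *ᵥ v = 0 := by
    ext i
    have hterm : ∀ j, M i j * v j = (if j = σ i then (if σ i ∈ S then (c i : ℝ) else 0) else 0)
        - (if j ∈ S ∧ A i j = -1 then 1 else 0) := by
      intro j
      by_cases hj : j = σ i
      · subst hj
        by_cases hS' : σ i ∈ S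
        · have hc : c i ≠ 0 := by
            obtain ⟨k, hk⟩ := (hfix i).1 hS'
            exact Finset.card_ne_zero_of_mem (a := k) (by simpa using hk)
          simp [M, v, hS', hc, hpos i]
        · simp [M, v, hS']
      · have h1 := hne i j hj
        by_cases hjS : j ∈ S
        · simp only [M, v, hj, hjS]
          revert h1
          cases A i j <;> simp
        · simp [M, v, hj, hjS]
    change ∑ j, M i j * v j = 0
    simp_rw [hterm]
    rw [Finset.sum_sub_distrib, Finset.sum_ite_eq' Finset.univ (σ i), Finset.sum_boole]
    by_cases hS' : σ i ∈ S
    · simp [hS', c]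
    · have : ∀ k, ¬ (k ∈ S ∧ A i k = -1) := fun k hk => hS' ((hfix i).2 ⟨k, hk⟩)
      simp [hS', this]
  exact hSNS M hM (Matrix.exists_mulVec_eq_zero_iff.1 ⟨v, hv, hMv⟩)

/-- The inverse of an invertible matrix over a field is a polynomial in that matrix. -/
theorem Matrix.exists_aeval_eq_inv {ι K : Type*} [Fintype ι] [DecidableEq ι] [Field K]
    {B : Matrix ι ι K} (hB : B.det ≠ 0) : ∃ g : Polynomial K, Polynomial.aeval B g = B⁻¹ := by
  have hc : B.charpoly.coeff 0 ≠ 0 := by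
    intro h
    apply hB
    rw [Matrix.det_eq_sign_charpoly_coeff, h, mul_zero]
  refine ⟨Polynomial.C (-(B.charpoly.coeff 0)⁻¹) * B.charpoly.divX, ?_⟩
  refine (Matrix.inv_eq_left_inv ?_).symm
  have h := B.aeval_self_charpoly
  rw [← B.charpoly.divX_mul_X_add] at h
  simp only [map_add, map_mul, Polynomial.aeval_X, Polynomial.aeval_C] at h
  rw [map_mul, Polynomial.aeval_C, mul_assoc, eq_neg_of_add_eq_zero_left h, map_neg, neg_mul_neg,
    ← map_mul, inv_mul_cancel₀ hc, map_one]

/-- A nonnegative matrix whose digraph contains the Hamiltonian cycle `i + 1 → i` is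
algebraically positive, witnessed by the sum of its first `n` powers. -/
theorem Matrix.sum_pow_pos_of_cycle {n : ℕ} [NeZero n] {C : Matrix (Fin n) (Fin n) ℝ}
    (hC : ∀ i j, 0 ≤ C i j) (hcyc : ∀ i, 0 < C (i + 1) i) (i j : Fin n) :
    0 < (∑ k ∈ Finset.range n, C ^ k) i j := by
  have hnn : ∀ (k : ℕ) (i j), 0 ≤ (C ^ k) i j := by
    intro k
    induction k with
    | zero =>
      intro i j
      rw [pow_zero, Matrix.one_apply]
      split_ifs <;> norm_num
    | succ k ih =>
      intro i j
      rw [pow_succ, Matrix.mul_apply]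
      exact Finset.sum_nonneg fun l _ => mul_nonneg (ih i l) (hC l j)
  have hpos : ∀ (k : ℕ) (j : Fin n), 0 < (C ^ k) (j + Fin.ofNat n k) j := by
    intro k
    induction k with
    | zero => intro j; simp
    | succ k ih =>
      intro j
      rw [pow_succ, Matrix.mul_apply]
      refine Finset.sum_pos' (fun l _ => mul_nonneg (hnn k _ l) (hC l j))
        ⟨j + 1, Finset.mem_univ _, mul_pos ?_ (hcyc j)⟩
      have h : j + Fin.ofNat n (k + 1) = j + 1 + Fin.ofNat n k := by
        have : Fin.ofNat n (k + 1) = 1 + Fin.ofNat n k := by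
          ext
          simp [Fin.val_add, Nat.add_comm]
        rw [this, add_assoc]
      rw [h]
      exact ih (j + 1)
  rw [Matrix.sum_apply]
  refine Finset.sum_pos' (fun k _ => hnn k i j)
    ⟨(i - j).val, Finset.mem_range.2 (i - j).isLt, ?_⟩
  have h := hpos (i - j).val j
  have h' : j + Fin.ofNat n (i - j).val = i := by
    simp
  rwa [h'] at h

/-- Cycle-form `A` with all directed 2-cycles negative and
`a_{i,i+1} = +` for all `i` (mod `n`): if `A` is SNS with nonpositive diagonal,
then `A` requires algebraic positivity. -/
theorem stmt_14 {n : ℕ} [NeZero n] (hn : 3 ≤ n) (A : Matrix (Fin n) (Fin n) SignType)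
    (hcyc : CycleForm A)
    (hneg2 : ∀ i j : Fin n, i ≠ j → A i j ≠ 0 → A j i ≠ 0 → A i j * A j i = -1)
    (hsup : ∀ i : Fin n, A i (i + 1) = 1)
    (hSNS : IsSNS A) (hdiag : ∀ i : Fin n, A i i ≠ 1) :
    RequiresAP A := by
  intro B hB
  have hne : ∀ i j : Fin n, j ≠ i + 1 → A i j ≠ 1 := by
    intro i j hj h1
    by_cases hij : i = j
    · exact hdiag i (hij ▸ h1)
    by_cases hji : i = j + 1
    · have hsj := hsup j
      rw [← hji] at hsj
      have h := hneg2 i j hij (by simp [h1]) (by simp [hsj])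
      rw [h1, hsj] at h
      exact absurd h (by decide)
    · simp [hcyc.1 i j hij hj hji] at h1
  have hdet : IsUnit B.det := isUnit_iff_ne_zero.2 (hSNS B hB)
  have hmul : B * B⁻¹ = 1 := Matrix.mul_nonsing_inv B hdet
  have hC : ∀ i j, 0 ≤ B⁻¹ i j := by
    intro i j
    refine hSNS.nonneg_of_mulVec_nonneg (Equiv.addRight 1) hsup hne hB
      (x := fun k => B⁻¹ k j) (fun k => ?_) i
    change 0 ≤ (B * B⁻¹) k j
    rw [hmul, Matrix.one_apply]
    split_ifs <;> norm_num
  have hC1 : ∀ i : Fin n, 0 < B⁻¹ (i + 1) i := by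
    intro i
    refine (hC _ _).lt_of_ne' fun h0 => ?_
    have h : ∑ k, B i k * B⁻¹ k i = 1 := by
      rw [← Matrix.mul_apply, hmul, Matrix.one_apply_eq]
    have hle : ∑ k, B i k * B⁻¹ k i ≤ 0 := by
      refine Finset.sum_nonpos fun k _ => ?_
      by_cases hk : k = i + 1
      · simp [hk, h0]
      · refine mul_nonpos_of_nonpos_of_nonneg (not_lt.1 fun hlt => hne i k hk ?_) (hC k i)
        rw [← hB i k, sign_pos hlt]
    linarith
  obtain ⟨g, hg⟩ := Matrix.exists_aeval_eq_inv (hSNS B hB)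
  refine ⟨∑ k ∈ Finset.range n, g ^ k, fun i j => ?_⟩
  simp only [map_sum, map_pow, hg]
  exact Matrix.sum_pow_pos_of_cycle hC hC1 i j
end
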